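/- For every point c ∈ ℝ², there do not exist seven pairwise disjoint closed disks of radius 1 in ℝ² that all intersect the circle {x ∈ ℝ² : dist(x, c) = 1}. -/

import Mathlib

open scoped Classical
open Pointwise Set Metric

noncomputable section

/-- The plane ℝ². -/
abbrev Plane : Type := EuclideanSpace ℝ (Fin 2)

/-- The closed convex cone C = {(x, y) : y ≤ −|x|} generated by (−1,−1) and (1,−1). -/
def quarterCone : Set Plane := {p : Plane | p 1 ≤ -|p 0|}

/-- Upper quarter convex hull of a set of points: the frontier of convexHull(S) + C. -/
def CHpts (S : Set Plane) : Set Plane := frontier (convexHull ℝ S + quarterCone)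

/-- Upper quarter outer convex hull of a family of regions. -/
def OCH {n : ℕ} (F : Fin n → Set Plane) : Set Plane :=
  frontier (convexHull ℝ (⋃ i, F i) + quarterCone)

/-- A point region is a singleton. -/
def IsPointRegion (R : Set Plane) : Prop := ∃ p : Plane, R = {p}

/-- A region is either a point region, or a compact connected set equal to the
closure of its nonempty interior. -/
def IsRegion (R : Set Plane) : Prop :=
  IsPointRegion R ∨
    (IsCompact R ∧ IsConnected R ∧ (interior R).Nonempty ∧ R = closure (interior R))

/-- A family of regions. -/
def RegionFamily {n : ℕ} (F : Fin n → Set Plane) : Prop := ∀ i, IsRegion (F i)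

/-- The partial order ≺_P on indices induced by the left-to-right traversal of CH(P). -/
def precOrder {n : ℕ} (P : Fin n → Plane) (a b : Fin n) : Prop :=
  P a ∈ CHpts (Set.range P) ∧ P b ∈ CHpts (Set.range P) ∧ P a 0 < P b 0

/-- A family is finished if all realisations induce the same partial order. -/
def Finished {n : ℕ} (F : Fin n → Set Plane) : Prop :=
  ∀ P₁ P₂ : Fin n → Plane, (∀ i, P₁ i ∈ F i) → (∀ i, P₂ i ∈ F i) →
    precOrder P₁ = precOrder P₂

/-- X is a witness: for every choice of points q_i ∈ R_i for regions outside X,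
replacing each region outside X by the corresponding point yields an unfinished family. -/
def IsWitness {n : ℕ} (F : Fin n → Set Plane) (X : Set (Fin n)) : Prop :=
  ∀ q : Fin n → Plane, (∀ i, i ∉ X → q i ∈ F i) →
    ¬ Finished (fun i => if i ∈ X then F i else {q i})

/-- p is a vertex of R: p lies on the frontier of R and every (nondegenerate) open
segment containing p contains a point off the frontier of R. -/
def IsVertex (R : Set Plane) (p : Plane) : Prop :=
  p ∈ frontier R ∧ ∀ q r : Plane, q ≠ r → p ∈ openSegment ℝ q r →
    ∃ z ∈ openSegment ℝ q r, z ∉ frontier R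

/-- p is a vertex of some region of the family F. -/
def FamVertex {n : ℕ} (F : Fin n → Set Plane) (p : Plane) : Prop := ∃ i, IsVertex (F i) p

/-- (s, t) is an edge of OCH(F): distinct vertices of V(F), the closed segment [s,t]
lies on OCH(F), and its relative interior contains no point of V(F). -/
def IsEdge {n : ℕ} (F : Fin n → Set Plane) (s t : Plane) : Prop :=
  s ≠ t ∧ FamVertex F s ∧ FamVertex F t ∧ segment ℝ s t ⊆ OCH F ∧
    ∀ p ∈ openSegment ℝ s t, ¬ FamVertex F p

/-- Two regions are strictly vertically separated. -/
def VertSep (R₁ R₂ : Set Plane) : Prop :=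
  ∃ x₀ : ℝ, ((∀ p ∈ R₁, p 0 < x₀) ∧ (∀ p ∈ R₂, x₀ < p 0)) ∨
            ((∀ p ∈ R₂, p 0 < x₀) ∧ (∀ p ∈ R₁, x₀ < p 0))

/-- A vertex x is canonical in F: it is exclusively a vertex of point regions, or a
vertex of exactly one non-point region. -/
def CanonicalVertex {n : ℕ} (F : Fin n → Set Plane) (x : Plane) : Prop :=
  (∀ i, IsVertex (F i) x → IsPointRegion (F i)) ∨
    (∃! i, IsVertex (F i) x ∧ ¬ IsPointRegion (F i))

/-- The pair (s, t) is canonical in F. -/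
def CanonicalPair {n : ℕ} (F : Fin n → Set Plane) (s t : Plane) : Prop :=
  CanonicalVertex F s ∧ CanonicalVertex F t

/-- band(R₁, R₂) = convexHull(R₁ ∪ R₂). -/
def band (R₁ R₂ : Set Plane) : Set Plane := convexHull ℝ (R₁ ∪ R₂)

/-- (s, t) with s ∈ V(R_a), t ∈ V(R_b) is dividing: canonical, and a = b or the two
regions are strictly vertically separated. -/
def DividingPair {n : ℕ} (F : Fin n → Set Plane) (a b : Fin n) (s t : Plane) : Prop :=
  IsVertex (F a) s ∧ IsVertex (F b) t ∧ CanonicalPair F s t ∧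
    (a = b ∨ VertSep (F a) (F b))

/-- (s, t) is dividing for some pair of regions. -/
def DividingEdge {n : ℕ} (F : Fin n → Set Plane) (s t : Plane) : Prop :=
  ∃ a b, DividingPair F a b s t

/-- (s, t) is occupied: dividing, and band(R_a, R_b) contains a vertex of
V(F − R_a − R_b) other than s and t. -/
def OccupiedEdge {n : ℕ} (F : Fin n → Set Plane) (s t : Plane) : Prop :=
  ∃ a b, DividingPair F a b s t ∧
    ∃ i, i ≠ a ∧ i ≠ b ∧ ∃ q, IsVertex (F i) q ∧ q ∈ band (F a) (F b) ∧ q ≠ s ∧ q ≠ t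

/-- A contiguous subchain w = (q, r, …, s, t) of OCH(F) (of m ≥ 2 edges) that is
spanning in F for the regions (R_a, R_b, R_c). -/
def SpanningSubchain {n : ℕ} (F : Fin n → Set Plane) (m : ℕ) (w : Fin (m + 1) → Plane)
    (a b c : Fin n) : Prop :=
  2 ≤ m ∧
  (∀ j : Fin m, IsEdge F (w j.castSucc) (w j.succ)) ∧
  (∀ j : Fin m, DividingEdge F (w j.castSucc) (w j.succ)) ∧
  IsVertex (F a) (w 0) ∧ IsVertex (F c) (w (Fin.last m)) ∧
  (∀ j : Fin (m + 1), 1 ≤ (j : ℕ) → (j : ℕ) ≤ m - 1 → IsVertex (F b) (w j)) ∧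
  (F b ∩ interior (convexHull ℝ (F a ∪ F c) + quarterCone)).Nonempty

/-- F is terminal: every edge of OCH(F) is dividing, no edge is occupied, and no
contiguous subchain of OCH(F) is spanning. -/
def Terminal {n : ℕ} (F : Fin n → Set Plane) : Prop :=
  (∀ s t, IsEdge F s t → DividingEdge F s t) ∧
  (∀ s t, IsEdge F s t → ¬ OccupiedEdge F s t) ∧
  ¬ ∃ (m : ℕ) (w : Fin (m + 1) → Plane) (a b c : Fin n), SpanningSubchain F m w a b c

/-- A region appears on OCH(F) if some point of it lies on OCH(F). -/
def Appears {n : ℕ} (F : Fin n → Set Plane) (R : Set Plane) : Prop :=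
  ∃ p ∈ R, p ∈ OCH F

/-- Two complex numbers in a disk about the origin whose arguments differ by at most `π / 3`
are no further apart than the radius of that disk. -/
theorem norm_sub_le_of_abs_arg_sub_arg_le {r : ℝ} {z w : ℂ} (hz : ‖z‖ ≤ r) (hw : ‖w‖ ≤ r)
    (h : |z.arg - w.arg| ≤ Real.pi / 3) : ‖z - w‖ ≤ r := by
  have hcos : 1 / 2 ≤ Real.cos (z.arg - w.arg) := by
    rw [← Real.cos_abs, ← Real.cos_pi_div_three]
    exact Real.cos_le_cos_of_nonneg_of_le_pi (abs_nonneg _) (by linarith [Real.pi_pos]) h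
  have hsq : ‖z - w‖ ^ 2 = ‖z‖ ^ 2 + ‖w‖ ^ 2 - 2 * (‖z‖ * ‖w‖ * Real.cos (z.arg - w.arg)) := by
    rw [Real.cos_sub]
    have hre : ‖z‖ * ‖w‖ * (Real.cos z.arg * Real.cos w.arg + Real.sin z.arg * Real.sin w.arg)
        = z.re * w.re + z.im * w.im := by
      rw [← Complex.norm_mul_cos_arg z, ← Complex.norm_mul_cos_arg w,
        ← Complex.norm_mul_sin_arg z, ← Complex.norm_mul_sin_arg w]
      ring
    rw [hre]
    simp only [Complex.sq_norm, Complex.normSq_apply, Complex.sub_re, Complex.sub_im]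
    ring
  have hmul := mul_le_mul_of_nonneg_left hcos (mul_nonneg (norm_nonneg z) (norm_nonneg w))
  refine abs_le_of_sq_le_sq' ?_ ((norm_nonneg z).trans hz) |>.2
  rcases le_total ‖z‖ ‖w‖ with hle | hle
  · nlinarith [norm_nonneg z, norm_nonneg w]
  · nlinarith [norm_nonneg z, norm_nonneg w]

/-- Among seven complex numbers, two have arguments that differ by at most `π / 3`. -/
theorem exists_ne_abs_arg_sub_arg_le (z : Fin 7 → ℂ) :
    ∃ i j, i ≠ j ∧ |(z i).arg - (z j).arg| ≤ Real.pi / 3 := by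
  have hpi : 0 < Real.pi / 3 := by positivity
  obtain ⟨i, -, j, -, hij, h⟩ := Finset.exists_ne_map_eq_of_card_lt_of_maps_to
    (s := Finset.univ) (t := Finset.Icc (-2 : ℤ) 3)
    (f := fun i => ⌈(z i).arg / (Real.pi / 3)⌉) (by simp) (by
      intro i _
      simp only [Finset.coe_Icc, Set.mem_Icc]
      refine ⟨Int.add_one_le_iff.2 (Int.lt_ceil.2 (?_ : ((-3 : ℤ) : ℝ) < _)), Int.ceil_le.2 ?_⟩
      · rw [lt_div_iff₀ hpi]
        push_cast
        linarith [Complex.neg_pi_lt_arg (z i)]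
      · rw [div_le_iff₀ hpi]
        push_cast
        linarith [Complex.arg_le_pi (z i)])
  refine ⟨i, j, hij, ?_⟩
  have hle : |(z i).arg / (Real.pi / 3) - (z j).arg / (Real.pi / 3)| ≤ 1 := by
    have hceil := congrArg (Int.cast : ℤ → ℝ) h
    rw [abs_le]
    constructor <;>
      linarith [Int.le_ceil ((z i).arg / (Real.pi / 3)), Int.le_ceil ((z j).arg / (Real.pi / 3)),
        Int.ceil_lt_add_one ((z i).arg / (Real.pi / 3)),
        Int.ceil_lt_add_one ((z j).arg / (Real.pi / 3))]
  rwa [← sub_div, abs_div, abs_of_pos hpi, div_le_one hpi] at hle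

/-- Seven pairwise disjoint closed unit disks cannot all intersect the
same unit circle. -/
theorem seven_disks (c : Plane) :
    ¬ ∃ z : Fin 7 → Plane,
      (∀ i j : Fin 7, i ≠ j →
        Disjoint (Metric.closedBall (z i) 1) (Metric.closedBall (z j) 1)) ∧
      (∀ i : Fin 7, (Metric.closedBall (z i) 1 ∩ Metric.sphere c 1).Nonempty) := by
  rintro ⟨z, hdisj, hmeet⟩
  let e := Complex.orthonormalBasisOneI.repr.symm
  have hnorm (i : Fin 7) : ‖e (z i - c)‖ ≤ 2 := by
    obtain ⟨x, hx, hxc⟩ := hmeet i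
    rw [mem_closedBall'] at hx
    rw [mem_sphere] at hxc
    rw [e.norm_map, ← dist_eq_norm]
    linarith [dist_triangle (z i) x c]
  obtain ⟨i, j, hij, harg⟩ := exists_ne_abs_arg_sub_arg_le fun i => e (z i - c)
  have hle := norm_sub_le_of_abs_arg_sub_arg_le (hnorm i) (hnorm j) harg
  rw [← map_sub, e.norm_map, sub_sub_sub_cancel_right, ← dist_eq_norm] at hle
  have hlt := (disjoint_closedBall_closedBall_iff zero_le_one zero_le_one).1 (hdisj i j hij)
  linarith
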